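/- arXiv:1611.03697 — 2 statements merged into one kernel-verified Lean document; each statement's English description precedes it below -/
import Mathlib

section
/- For every w ∈ ℂ ∖ ℝ≤0 the functions Λ and Υ are differentiable at w with Λ(w) ≠ 0 and Υ(w) ≠ 0, and the logarithmic derivatives satisfy Υ′(w)/Υ(w) = w · Λ′(w)/Λ(w); equivalently Υ′(w) · Λ(w) = w · Λ′(w) · Υ(w). -/
/-- The function `Λ(w) = e^w · Γ(w) / (√(2π) · w^{w - 1/2})`, where the power
`w^{w-1/2} = exp((w - 1/2) · Log w)` is defined using the principal branch of
the complex logarithm. -/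
noncomputable def Lam (w : ℂ) : ℂ :=
  Complex.exp w * Complex.Gamma w /
    (Real.sqrt (2 * Real.pi) * Complex.exp ((w - 1 / 2) * Complex.log w))

/-- The Barnes G-function evaluated at `1 + w`, defined by the Weierstrass product
`G(1+w) = (2π)^{w/2} · exp(−(w + (1+γ)w²)/2) · ∏_{k≥1} (1 + w/k)^k · exp(w²/(2k) − w)`,
where `γ` is the Euler–Mascheroni constant and `(2π)^{w/2} = exp((w/2)·log(2π))`. -/
noncomputable def BarnesG1 (w : ℂ) : ℂ :=
  Complex.exp ((w / 2) * Real.log (2 * Real.pi)) *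
    Complex.exp (-(w + (1 + Real.eulerMascheroniConstant) * w ^ 2) / 2) *
    ∏' k : ℕ, ((1 + w / (k + 1)) ^ (k + 1) * Complex.exp (w ^ 2 / (2 * (k + 1)) - w))

/-- `Υ(w) = e^{−ζ′(−1)} · e^{(3/4)w²} · G(1+w) / ((2π)^{w/2} · w^{w²/2})`, with
`w^{w²/2} = exp((w²/2) · Log w)` defined via the principal branch of `Log`. -/
noncomputable def Ups (w : ℂ) : ℂ :=
  Complex.exp (-(deriv riemannZeta (-1))) * Complex.exp ((3 / 4 : ℂ) * w ^ 2) * BarnesG1 w /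
    (Complex.exp ((w / 2) * Real.log (2 * Real.pi)) *
      Complex.exp ((w ^ 2 / 2) * Complex.log w))

open Filter Topology Metric

/-- The factor `(1 + w/n) e^{-w/n}`, `n = k + 1`, of the Weierstrass product of `1/Γ`. -/
noncomputable def gammaFactor (k : ℕ) (w : ℂ) : ℂ :=
  (1 + w / (k + 1)) * Complex.exp (-(w / (k + 1)))

/-- The factor `(1 + w/n)^n e^{w²/(2n) - w}`, `n = k + 1`, of the Weierstrass product of the
Barnes G-function. -/
noncomputable def barnesFactor (k : ℕ) (w : ℂ) : ℂ :=
  (1 + w / (k + 1)) ^ (k + 1) * Complex.exp (w ^ 2 / (2 * (k + 1)) - w)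

lemma summable_div_nat_add_one_sq (C : ℝ) : Summable fun k : ℕ ↦ C / ((k : ℝ) + 1) ^ 2 := by
  have h := (summable_nat_add_iff 1).2 (Real.summable_one_div_nat_pow.2 (one_lt_two))
  simpa [div_eq_mul_inv] using h.mul_left C

section Product

variable {f : ℕ → ℂ → ℂ} {R C : ℝ}

lemma eventually_norm_sub_one_le_of_eq_exp
    (hb : ∀ᶠ k : ℕ in atTop, ∀ w ∈ ball (0 : ℂ) R,
      ∃ u, f k w = Complex.exp u ∧ ‖u‖ ≤ C / ((k : ℝ) + 1) ^ 2) :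
    ∀ᶠ k : ℕ in atTop, ∀ w ∈ ball (0 : ℂ) R, ‖f k w - 1‖ ≤ 2 * C / ((k : ℝ) + 1) ^ 2 := by
  have h1 := (summable_div_nat_add_one_sq C).tendsto_atTop_zero.eventually_le_const one_pos
  filter_upwards [hb, h1] with k hk h1 w hw
  obtain ⟨u, hu, hle⟩ := hk w hw
  rw [hu, mul_div_assoc]
  exact (Complex.norm_exp_sub_one_le (hle.trans h1)).trans (by gcongr)

lemma multipliableLocallyUniformlyOn_ball_of_eq_exp (hf : ∀ k, Differentiable ℂ (f k))
    (hb : ∀ᶠ k : ℕ in atTop, ∀ w ∈ ball (0 : ℂ) R,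
      ∃ u, f k w = Complex.exp u ∧ ‖u‖ ≤ C / ((k : ℝ) + 1) ^ 2) :
    MultipliableLocallyUniformlyOn f (ball 0 R) := by
  simpa using Summable.multipliableLocallyUniformlyOn_nat_one_add (f := fun k w ↦ f k w - 1) isOpen_ball
    (summable_div_nat_add_one_sq (2 * C)) (eventually_norm_sub_one_le_of_eq_exp hb)
    fun k ↦ ((hf k).continuous.sub continuous_const).continuousOn

lemma tprod_ne_zero_of_eq_exp
    (hb : ∀ᶠ k : ℕ in atTop, ∀ w ∈ ball (0 : ℂ) R,
      ∃ u, f k w = Complex.exp u ∧ ‖u‖ ≤ C / ((k : ℝ) + 1) ^ 2)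
    {w : ℂ} (hw : w ∈ ball 0 R) (hne : ∀ k, f k w ≠ 0) : ∏' k, f k w ≠ 0 := by
  have hs : Summable fun k ↦ ‖f k w - 1‖ := by
    refine .of_norm_bounded_eventually_nat (summable_div_nat_add_one_sq (2 * C)) ?_
    filter_upwards [eventually_norm_sub_one_le_of_eq_exp hb] with k hk
    simpa using hk w hw
  simpa using tprod_one_add_ne_zero_of_summable (f := fun k ↦ f k w - 1) (by simpa using hne) hs

lemma differentiableAt_tprod_of_eq_exp (hf : ∀ k, Differentiable ℂ (f k))
    (hb : ∀ᶠ k : ℕ in atTop, ∀ w ∈ ball (0 : ℂ) R,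
      ∃ u, f k w = Complex.exp u ∧ ‖u‖ ≤ C / ((k : ℝ) + 1) ^ 2)
    {w : ℂ} (hw : w ∈ ball 0 R) : DifferentiableAt ℂ (fun z ↦ ∏' k, f k z) w := by
  have h := (multipliableLocallyUniformlyOn_ball_of_eq_exp hf hb).hasProdLocallyUniformlyOn
  refine (TendstoLocallyUniformlyOn.differentiableOn h (.of_forall fun s ↦ ?_)
    isOpen_ball).differentiableAt (isOpen_ball.mem_nhds hw)
  exact DifferentiableOn.fun_finsetProd fun k _ ↦ (hf k).differentiableOn

end Product

lemma eventually_norm_div_le (R : ℝ) : ∀ᶠ k : ℕ in atTop, ∀ w ∈ ball (0 : ℂ) R,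
    ‖w / ((k : ℂ) + 1)‖ ≤ R / ((k : ℝ) + 1) ∧ R / ((k : ℝ) + 1) ≤ 1 / 2 := by
  filter_upwards [eventually_ge_atTop ⌈2 * R⌉₊] with k hk w hw
  have hk' : 2 * R ≤ k := Nat.ceil_le.1 hk
  have hpos : (0 : ℝ) < (k : ℝ) + 1 := by positivity
  have hn : ‖(k : ℂ) + 1‖ = (k : ℝ) + 1 := by exact_mod_cast Complex.norm_natCast (k + 1)
  rw [norm_div, hn]
  refine ⟨by gcongr; exact (mem_ball_zero_iff.1 hw).le, ?_⟩
  rw [div_le_iff₀ hpos]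
  linarith

lemma one_add_ne_zero_of_norm_le_half {z : ℂ} (hz : ‖z‖ ≤ 1 / 2) : 1 + z ≠ 0 := by
  intro h
  rw [eq_neg_of_add_eq_zero_right h] at hz
  norm_num at hz

lemma inv_one_sub_le_two {x : ℝ} (hx : x ≤ 1 / 2) : (1 - x)⁻¹ ≤ 2 :=
  inv_le_of_inv_le₀ (by norm_num) (by linarith)

lemma gammaFactor_eq_exp (R : ℝ) : ∀ᶠ k : ℕ in atTop, ∀ w ∈ ball (0 : ℂ) R,
    ∃ u, gammaFactor k w = Complex.exp u ∧ ‖u‖ ≤ R ^ 2 / ((k : ℝ) + 1) ^ 2 := by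
  filter_upwards [eventually_norm_div_le R] with k hk w hw
  obtain ⟨hz, hR⟩ := hk w hw
  set z := w / ((k : ℂ) + 1) with hz_def
  have hz2 := hz.trans hR
  refine ⟨Complex.log (1 + z) - z, ?_, ?_⟩
  · rw [sub_eq_add_neg, Complex.exp_add, Complex.exp_log (one_add_ne_zero_of_norm_le_half hz2),
      gammaFactor]
  · calc ‖Complex.log (1 + z) - z‖ ≤ ‖z‖ ^ 2 * (1 - ‖z‖)⁻¹ / 2 :=
          Complex.norm_log_one_add_sub_self_le (by linarith)
      _ ≤ ‖z‖ ^ 2 * 2 / 2 := by gcongr; exact inv_one_sub_le_two hz2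
      _ = ‖z‖ ^ 2 := by ring
      _ ≤ (R / ((k : ℝ) + 1)) ^ 2 := by gcongr
      _ = _ := by rw [div_pow]

lemma barnesFactor_eq_exp (R : ℝ) : ∀ᶠ k : ℕ in atTop, ∀ w ∈ ball (0 : ℂ) R,
    ∃ u, barnesFactor k w = Complex.exp u ∧ ‖u‖ ≤ R ^ 3 / ((k : ℝ) + 1) ^ 2 := by
  filter_upwards [eventually_norm_div_le R] with k hk w hw
  obtain ⟨hz, hR⟩ := hk w hw
  have hk0 : (k : ℂ) + 1 ≠ 0 := Nat.cast_add_one_ne_zero k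
  set z := w / ((k : ℂ) + 1) with hz_def
  have hw_eq : w = (k + 1) * z := by rw [hz_def]; field_simp
  have hz2 := hz.trans hR
  have hn : ‖(k : ℂ) + 1‖ = (k : ℝ) + 1 := by exact_mod_cast Complex.norm_natCast (k + 1)
  refine ⟨(k + 1) * (Complex.log (1 + z) - (z - z ^ 2 / 2)), ?_, ?_⟩
  · have : (k + 1) * (Complex.log (1 + z) - (z - z ^ 2 / 2)) =
        ((k + 1 : ℕ) : ℂ) * Complex.log (1 + z) + (w ^ 2 / (2 * (k + 1)) - w) := by
      rw [hw_eq]; push_cast; field_simp; ring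
    rw [this, Complex.exp_add, Complex.exp_nat_mul,
      Complex.exp_log (one_add_ne_zero_of_norm_le_half hz2), barnesFactor]
  · have hlog := Complex.norm_log_sub_logTaylor_le 2 (z := z) (by linarith)
    have htay : Complex.logTaylor (2 + 1) z = z - z ^ 2 / 2 := by
      simp [Complex.logTaylor, Finset.sum_range_succ]; ring
    rw [htay] at hlog
    rw [norm_mul, hn]
    calc ((k : ℝ) + 1) * ‖Complex.log (1 + z) - (z - z ^ 2 / 2)‖
        ≤ (k + 1) * (‖z‖ ^ 3 * (1 - ‖z‖)⁻¹ / 3) := by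
          gcongr; norm_num at hlog ⊢; exact hlog
      _ ≤ (k + 1) * (‖z‖ ^ 3 * 2 / 2) := by
          gcongr
          · exact inv_one_sub_le_two hz2
          · norm_num
      _ = (k + 1) * ‖z‖ ^ 3 := by ring
      _ ≤ (k + 1) * (R / ((k : ℝ) + 1)) ^ 3 := by gcongr
      _ = _ := by field_simp

lemma differentiable_gammaFactor (k : ℕ) : Differentiable ℂ (gammaFactor k) := by
  unfold gammaFactor; fun_prop

lemma differentiable_barnesFactor (k : ℕ) : Differentiable ℂ (barnesFactor k) := by
  unfold barnesFactor; fun_prop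

lemma mem_ball_norm_add_one (w : ℂ) : w ∈ ball (0 : ℂ) (‖w‖ + 1) := by simp

section SlitPlane

variable {w : ℂ}

lemma neg_natCast_notMem_slitPlane (m : ℕ) : -(m : ℂ) ∉ Complex.slitPlane := by
  simp [Complex.mem_slitPlane_iff]

lemma add_natCast_add_one_ne_zero (hw : w ∈ Complex.slitPlane) (k : ℕ) : (k : ℂ) + 1 + w ≠ 0 := by
  intro h
  have : w = -((k + 1 : ℕ) : ℂ) := by push_cast; linear_combination h
  rw [this] at hw
  exact neg_natCast_notMem_slitPlane _ hw

lemma one_add_div_ne_zero (hw : w ∈ Complex.slitPlane) (k : ℕ) : 1 + w / ((k : ℂ) + 1) ≠ 0 := by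
  have hk0 : (k : ℂ) + 1 ≠ 0 := Nat.cast_add_one_ne_zero k
  rw [one_add_div hk0]
  exact div_ne_zero (add_natCast_add_one_ne_zero hw k) hk0

lemma gammaFactor_ne_zero (hw : w ∈ Complex.slitPlane) (k : ℕ) : gammaFactor k w ≠ 0 :=
  mul_ne_zero (one_add_div_ne_zero hw k) (Complex.exp_ne_zero _)

lemma barnesFactor_ne_zero (hw : w ∈ Complex.slitPlane) (k : ℕ) : barnesFactor k w ≠ 0 :=
  mul_ne_zero (pow_ne_zero _ (one_add_div_ne_zero hw k)) (Complex.exp_ne_zero _)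

lemma Gamma_ne_zero_of_mem_slitPlane (hw : w ∈ Complex.slitPlane) : Complex.Gamma w ≠ 0 :=
  Complex.Gamma_ne_zero fun m hm ↦ neg_natCast_notMem_slitPlane m (hm ▸ hw)

lemma differentiableAt_Gamma_of_mem_slitPlane (hw : w ∈ Complex.slitPlane) :
    DifferentiableAt ℂ Complex.Gamma w :=
  Complex.differentiableAt_Gamma _ fun m hm ↦ neg_natCast_notMem_slitPlane m (hm ▸ hw)

lemma logDeriv_exp_comp {g : ℂ → ℂ} {g' : ℂ} (hg : HasDerivAt g g' w) :
    logDeriv (fun z ↦ Complex.exp (g z)) w = g' := by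
  rw [logDeriv_apply, hg.cexp.deriv, mul_div_cancel_left₀ _ (Complex.exp_ne_zero _)]

lemma logDeriv_exp_comp_mul {g h : ℂ → ℂ} {g' : ℂ} (hg : HasDerivAt g g' w) (hh : h w ≠ 0)
    (hd : DifferentiableAt ℂ h w) :
    logDeriv (fun z ↦ Complex.exp (g z) * h z) w = g' + logDeriv h w := by
  rw [logDeriv_mul (f := fun z ↦ Complex.exp (g z)) _ (Complex.exp_ne_zero _) hh
    hg.differentiableAt.cexp hd, logDeriv_exp_comp hg]

lemma logDeriv_one_add_div (k : ℕ) (w : ℂ) :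
    logDeriv (fun z : ℂ ↦ 1 + z / ((k : ℂ) + 1)) w = 1 / (k + 1 + w) := by
  have hk0 : (k : ℂ) + 1 ≠ 0 := Nat.cast_add_one_ne_zero k
  have h : HasDerivAt (fun z : ℂ ↦ 1 + z / ((k : ℂ) + 1)) (1 / (k + 1)) w :=
    ((hasDerivAt_id w).div_const _).const_add 1
  rw [logDeriv_apply, h.deriv, one_add_div hk0, div_div_div_cancel_right₀ hk0]

lemma logDeriv_gammaFactor (hw : w ∈ Complex.slitPlane) (k : ℕ) :
    logDeriv (gammaFactor k) w = 1 / (k + 1 + w) - 1 / (k + 1) := by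
  unfold gammaFactor
  rw [logDeriv_mul (f := fun z ↦ 1 + z / ((k : ℂ) + 1))
    (g := fun z ↦ Complex.exp (-(z / ((k : ℂ) + 1)))) _ (one_add_div_ne_zero hw k) (Complex.exp_ne_zero _) (by fun_prop)
    (by fun_prop), logDeriv_one_add_div,
    logDeriv_exp_comp ((hasDerivAt_id' w).div_const ((k : ℂ) + 1)).fun_neg]
  ring

lemma logDeriv_barnesFactor (hw : w ∈ Complex.slitPlane) (k : ℕ) :
    logDeriv (barnesFactor k) w = -w * logDeriv (gammaFactor k) w := by
  have hk0 : (k : ℂ) + 1 ≠ 0 := Nat.cast_add_one_ne_zero k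
  have hkw := add_natCast_add_one_ne_zero hw k
  have hg : HasDerivAt (fun z : ℂ ↦ z ^ 2 / (2 * ((k : ℂ) + 1)) - z)
      (2 * w / (2 * ((k : ℂ) + 1)) - 1) w := by
    simpa using ((hasDerivAt_pow 2 w).div_const (2 * ((k : ℂ) + 1))).fun_sub (hasDerivAt_id' w)
  rw [logDeriv_gammaFactor hw]
  unfold barnesFactor
  rw [logDeriv_mul (f := fun z ↦ (1 + z / ((k : ℂ) + 1)) ^ (k + 1))
    (g := fun z ↦ Complex.exp (z ^ 2 / (2 * ((k : ℂ) + 1)) - z)) _ (pow_ne_zero _ (one_add_div_ne_zero hw k)) (Complex.exp_ne_zero _)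
    (by fun_prop) (by fun_prop), logDeriv_fun_pow (f := fun z ↦ 1 + z / ((k : ℂ) + 1)) (by fun_prop), logDeriv_one_add_div,
    logDeriv_exp_comp hg]
  push_cast
  field_simp
  ring

lemma summable_logDeriv_gammaFactor (hw : w ∈ Complex.slitPlane) :
    Summable fun k ↦ logDeriv (gammaFactor k) w := by
  refine .of_norm_bounded_eventually_nat (summable_div_nat_add_one_sq (2 * ‖w‖)) ?_
  filter_upwards [eventually_norm_div_le (‖w‖ + 1)] with k hk
  obtain ⟨hz, hR⟩ := hk w (mem_ball_norm_add_one w)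
  have hk0 : (k : ℂ) + 1 ≠ 0 := Nat.cast_add_one_ne_zero k
  have hn : ‖(k : ℂ) + 1‖ = (k : ℝ) + 1 := by exact_mod_cast Complex.norm_natCast (k + 1)
  have hkw := add_natCast_add_one_ne_zero hw k
  have hone := one_add_div_ne_zero hw k
  have heq : 1 / ((k : ℂ) + 1 + w) - 1 / (k + 1) =
      -(w / (k + 1) ^ 2) * (1 + w / (k + 1))⁻¹ := by
    rw [one_add_div hk0]
    field_simp
    ring
  have hlow : 1 / 2 ≤ ‖1 + w / ((k : ℂ) + 1)‖ := by
    have := norm_sub_le (1 + w / ((k : ℂ) + 1)) (w / (k + 1))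
    rw [add_sub_cancel_right, norm_one] at this
    linarith
  rw [logDeriv_gammaFactor hw, heq, norm_mul, norm_neg, norm_div, norm_pow, hn, norm_inv]
  calc ‖w‖ / ((k : ℝ) + 1) ^ 2 * ‖1 + w / ((k : ℂ) + 1)‖⁻¹
      ≤ ‖w‖ / ((k : ℝ) + 1) ^ 2 * 2 := by
        gcongr
        exact inv_le_of_inv_le₀ (by norm_num) (by linarith)
    _ = _ := by ring

lemma logDeriv_tprod_gammaFactor (hw : w ∈ Complex.slitPlane) :
    logDeriv (fun z ↦ ∏' k, gammaFactor k z) w = ∑' k, logDeriv (gammaFactor k) w :=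
  logDeriv_tprod_eq_tsum isOpen_ball (mem_ball_norm_add_one w) (gammaFactor_ne_zero hw)
    (fun k ↦ (differentiable_gammaFactor k).differentiableOn) (summable_logDeriv_gammaFactor hw)
    (multipliableLocallyUniformlyOn_ball_of_eq_exp differentiable_gammaFactor
      (gammaFactor_eq_exp _))
    (tprod_ne_zero_of_eq_exp (gammaFactor_eq_exp _) (mem_ball_norm_add_one w)
      (gammaFactor_ne_zero hw))

lemma tprod_barnesFactor_ne_zero (hw : w ∈ Complex.slitPlane) : ∏' k, barnesFactor k w ≠ 0 :=
  tprod_ne_zero_of_eq_exp (barnesFactor_eq_exp _) (mem_ball_norm_add_one w)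
    (barnesFactor_ne_zero hw)

lemma logDeriv_tprod_barnesFactor (hw : w ∈ Complex.slitPlane) :
    logDeriv (fun z ↦ ∏' k, barnesFactor k z) w = -w * ∑' k, logDeriv (gammaFactor k) w := by
  rw [← tsum_mul_left]
  simp_rw [← logDeriv_barnesFactor hw]
  refine logDeriv_tprod_eq_tsum isOpen_ball (mem_ball_norm_add_one w) (barnesFactor_ne_zero hw)
    (fun k ↦ (differentiable_barnesFactor k).differentiableOn) ?_
    (multipliableLocallyUniformlyOn_ball_of_eq_exp differentiable_barnesFactor
      (barnesFactor_eq_exp _)) (tprod_barnesFactor_ne_zero hw)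
  simp_rw [logDeriv_barnesFactor hw]
  exact (summable_logDeriv_gammaFactor hw).mul_left _

lemma GammaSeq_mul_prod_gammaFactor (hw : w ∈ Complex.slitPlane) {n : ℕ} (hn : n ≠ 0) :
    Complex.GammaSeq w n * (w * ∏ k ∈ Finset.range n, gammaFactor k w) =
      Complex.exp (-(((harmonic n - Real.log n : ℝ) : ℂ) * w)) := by
  have hprod : ∏ j ∈ Finset.range (n + 1), (w + j) =
      w * (n.factorial * ∏ k ∈ Finset.range n, (1 + w / ((k : ℂ) + 1))) := by
    rw [Finset.prod_range_succ', ← Finset.prod_range_add_one_eq_factorial, Nat.cast_prod,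
      ← Finset.prod_mul_distrib, mul_comm]
    congr 1
    · simp
    · refine Finset.prod_congr rfl fun k _ ↦ ?_
      have hk0 : (k : ℂ) + 1 ≠ 0 := Nat.cast_add_one_ne_zero k
      push_cast
      field_simp
      ring
  have hexp : ∏ k ∈ Finset.range n, Complex.exp (-(w / ((k : ℂ) + 1))) =
      Complex.exp (-((harmonic n : ℂ) * w)) := by
    rw [← Complex.exp_sum, harmonic]
    congr 1
    push_cast
    rw [Finset.sum_mul, ← Finset.sum_neg_distrib]
    exact Finset.sum_congr rfl fun k _ ↦ by ring
  have hP : ∏ k ∈ Finset.range n, (1 + w / ((k : ℂ) + 1)) ≠ 0 :=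
    Finset.prod_ne_zero_iff.2 fun k _ ↦ one_add_div_ne_zero hw k
  have hw0 := Complex.slitPlane_ne_zero hw
  have hfac : (n.factorial : ℂ) ≠ 0 := by exact_mod_cast n.factorial_ne_zero
  have hn' : (n : ℂ) ≠ 0 := by exact_mod_cast hn
  have hsplit : Complex.exp (-(((harmonic n - Real.log n : ℝ) : ℂ) * w)) =
      (n : ℂ) ^ w * Complex.exp (-((harmonic n : ℂ) * w)) := by
    rw [Complex.cpow_def_of_ne_zero hn', ← Complex.exp_add, Complex.natCast_log.symm]
    congr 1
    push_cast
    ring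
  unfold gammaFactor
  rw [Finset.prod_mul_distrib, hexp, hsplit, Complex.GammaSeq, hprod]
  generalize ∏ k ∈ Finset.range n, (1 + w / ((k : ℂ) + 1)) = P at hP ⊢
  field_simp

lemma Gamma_mul_tprod_gammaFactor (hw : w ∈ Complex.slitPlane) :
    Complex.Gamma w * (w * ∏' k, gammaFactor k w) =
      Complex.exp (-((Real.eulerMascheroniConstant : ℂ) * w)) := by
  have hm := (multipliableLocallyUniformlyOn_ball_of_eq_exp differentiable_gammaFactor
    (gammaFactor_eq_exp (‖w‖ + 1))).multipliable (mem_ball_norm_add_one w)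
  have h1 := (Complex.GammaSeq_tendsto_Gamma w).mul (hm.hasProd.tendsto_prod_nat.const_mul w)
  have h2 : Tendsto (fun n : ℕ ↦ Complex.exp (-(((harmonic n - Real.log n : ℝ) : ℂ) * w))) atTop
      (𝓝 (Complex.exp (-((Real.eulerMascheroniConstant : ℂ) * w)))) :=
    (Complex.continuous_exp.tendsto _).comp
      (((Complex.continuous_ofReal.tendsto _).comp Real.tendsto_harmonic_sub_log).mul_const w).neg
  refine tendsto_nhds_unique (h1.congr' ?_) h2
  filter_upwards [eventually_ne_atTop 0] with n hn using GammaSeq_mul_prod_gammaFactor hw hn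

/-- The partial fraction expansion of the digamma function. -/
lemma digamma_add_inv_add_tsum (hw : w ∈ Complex.slitPlane) :
    Complex.digamma w + 1 / w + ∑' k, logDeriv (gammaFactor k) w =
      -Real.eulerMascheroniConstant := by
  have hw0 := Complex.slitPlane_ne_zero hw
  have hP : ∏' k, gammaFactor k w ≠ 0 := tprod_ne_zero_of_eq_exp (gammaFactor_eq_exp _)
    (mem_ball_norm_add_one w) (gammaFactor_ne_zero hw)
  have hPd := differentiableAt_tprod_of_eq_exp differentiable_gammaFactor (gammaFactor_eq_exp _)
    (mem_ball_norm_add_one w)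
  have heq : (fun z ↦ Complex.Gamma z * (z * ∏' k, gammaFactor k z)) =ᶠ[𝓝 w]
      fun z ↦ Complex.exp (-((Real.eulerMascheroniConstant : ℂ) * z)) := by
    filter_upwards [Complex.isOpen_slitPlane.mem_nhds hw] with z hz
      using Gamma_mul_tprod_gammaFactor hz
  have hlog : logDeriv (fun z ↦ Complex.Gamma z * (z * ∏' k, gammaFactor k z)) w =
      logDeriv (fun z ↦ Complex.exp (-((Real.eulerMascheroniConstant : ℂ) * z))) w := by
    rw [logDeriv_apply, logDeriv_apply, heq.deriv_eq, heq.eq_of_nhds]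
  have hlin : HasDerivAt (fun z : ℂ ↦ -((Real.eulerMascheroniConstant : ℂ) * z))
      (-Real.eulerMascheroniConstant) w := by
    simpa using ((hasDerivAt_id' w).const_mul (Real.eulerMascheroniConstant : ℂ)).fun_neg
  rw [logDeriv_exp_comp hlin, logDeriv_mul (g := fun z ↦ z * ∏' k, gammaFactor k z) _ (Gamma_ne_zero_of_mem_slitPlane hw)
    (mul_ne_zero hw0 hP) (differentiableAt_Gamma_of_mem_slitPlane hw)
    (differentiableAt_fun_id.fun_mul hPd),
    logDeriv_mul (f := fun z ↦ z) _ hw0 hP differentiableAt_fun_id hPd,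
    logDeriv_id', logDeriv_tprod_gammaFactor hw] at hlog
  rw [← hlog, Complex.digamma_def]
  ring

lemma Lam_ne_zero (hw : w ∈ Complex.slitPlane) : Lam w ≠ 0 := by
  have h2π : ((√(2 * Real.pi) : ℝ) : ℂ) ≠ 0 := by
    exact_mod_cast (Real.sqrt_pos.2 Real.two_pi_pos).ne'
  exact div_ne_zero (mul_ne_zero (Complex.exp_ne_zero _) (Gamma_ne_zero_of_mem_slitPlane hw))
    (mul_ne_zero h2π (Complex.exp_ne_zero _))

lemma differentiableAt_Lam (hw : w ∈ Complex.slitPlane) : DifferentiableAt ℂ Lam w := by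
  have h2π : ((√(2 * Real.pi) : ℝ) : ℂ) ≠ 0 := by
    exact_mod_cast (Real.sqrt_pos.2 Real.two_pi_pos).ne'
  have hG := differentiableAt_Gamma_of_mem_slitPlane hw
  have hL := Complex.differentiableAt_log hw
  unfold Lam
  exact (by fun_prop : DifferentiableAt ℂ (fun z ↦ Complex.exp z * Complex.Gamma z) w).fun_div
    (by fun_prop) (mul_ne_zero h2π (Complex.exp_ne_zero _))

lemma logDeriv_Lam (hw : w ∈ Complex.slitPlane) :
    logDeriv Lam w = Complex.digamma w - Complex.log w + 1 / (2 * w) := by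
  have h2π : ((√(2 * Real.pi) : ℝ) : ℂ) ≠ 0 := by
    exact_mod_cast (Real.sqrt_pos.2 Real.two_pi_pos).ne'
  have hw0 := Complex.slitPlane_ne_zero hw
  have hG := differentiableAt_Gamma_of_mem_slitPlane hw
  have hL := Complex.differentiableAt_log hw
  have hpow := ((hasDerivAt_id' w).sub_const (1 / 2)).fun_mul (Complex.hasDerivAt_log hw)
  unfold Lam
  rw [logDeriv_div (f := fun z ↦ Complex.exp z * Complex.Gamma z)
    (g := fun z ↦ √(2 * Real.pi) * Complex.exp ((z - 1 / 2) * Complex.log z)) _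
    (mul_ne_zero (Complex.exp_ne_zero _) (Gamma_ne_zero_of_mem_slitPlane hw))
    (mul_ne_zero h2π (Complex.exp_ne_zero _)) (by fun_prop) (by fun_prop),
    logDeriv_exp_comp_mul (hasDerivAt_id' w) (Gamma_ne_zero_of_mem_slitPlane hw) hG,
    logDeriv_const_mul _ _ h2π, logDeriv_exp_comp hpow, Complex.digamma_def]
  field_simp
  ring

/-- `Υ` is a constant times an exponential times the Barnes product. -/
lemma Ups_eq (w : ℂ) :
    Ups w = Complex.exp (-(deriv riemannZeta (-1))) *
      (Complex.exp ((3 / 4 : ℂ) * w ^ 2 -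
          (w + (1 + Real.eulerMascheroniConstant) * w ^ 2) / 2 - w ^ 2 / 2 * Complex.log w) *
        ∏' k, barnesFactor k w) := by
  unfold Ups BarnesG1 barnesFactor
  rw [Complex.exp_sub, Complex.exp_sub, neg_div, Complex.exp_neg (_ / 2)]
  field_simp

lemma hasDerivAt_Ups_exponent (hw : w ∈ Complex.slitPlane) :
    HasDerivAt (fun z : ℂ ↦ (3 / 4 : ℂ) * z ^ 2 -
        (z + (1 + Real.eulerMascheroniConstant) * z ^ 2) / 2 - z ^ 2 / 2 * Complex.log z)
      (-(1 / 2) - Real.eulerMascheroniConstant * w - w * Complex.log w) w := by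
  have hw0 := Complex.slitPlane_ne_zero hw
  have hsq := hasDerivAt_pow 2 w
  convert! ((hsq.const_mul (3 / 4 : ℂ)).fun_sub (((hasDerivAt_id' w).fun_add
    (hsq.const_mul (1 + (Real.eulerMascheroniConstant : ℂ)))).div_const 2)).fun_sub
    ((hsq.div_const 2).fun_mul (Complex.hasDerivAt_log hw)) using 1
  push_cast
  field_simp
  ring

lemma differentiableAt_tprod_barnesFactor (w : ℂ) :
    DifferentiableAt ℂ (fun z ↦ ∏' k, barnesFactor k z) w :=
  differentiableAt_tprod_of_eq_exp differentiable_barnesFactor (barnesFactor_eq_exp _)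
    (mem_ball_norm_add_one w)

lemma Ups_ne_zero (hw : w ∈ Complex.slitPlane) : Ups w ≠ 0 := by
  rw [Ups_eq]
  exact mul_ne_zero (Complex.exp_ne_zero _)
    (mul_ne_zero (Complex.exp_ne_zero _) (tprod_barnesFactor_ne_zero hw))

lemma differentiableAt_Ups (hw : w ∈ Complex.slitPlane) : DifferentiableAt ℂ Ups w := by
  rw [funext Ups_eq]
  exact ((hasDerivAt_Ups_exponent hw).differentiableAt.cexp.fun_mul
    (differentiableAt_tprod_barnesFactor w)).const_mul _

lemma logDeriv_Ups (hw : w ∈ Complex.slitPlane) : logDeriv Ups w = w * logDeriv Lam w := by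
  have hw0 := Complex.slitPlane_ne_zero hw
  have hψ := digamma_add_inv_add_tsum hw
  have hg := hasDerivAt_Ups_exponent hw
  rw [logDeriv_Lam hw, funext Ups_eq, logDeriv_const_mul _ _ (Complex.exp_ne_zero _),
    logDeriv_exp_comp_mul hg (tprod_barnesFactor_ne_zero hw)
      (differentiableAt_tprod_barnesFactor w), logDeriv_tprod_barnesFactor hw]
  field_simp at hψ ⊢
  linear_combination (-2) * hψ

end SlitPlane

/-- On the slit plane `Λ` and `Υ` are differentiable and nonvanishing,
and their logarithmic derivatives satisfy `Υ′(w)/Υ(w) = w · Λ′(w)/Λ(w)`, i.e.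
`Υ′(w) · Λ(w) = w · Λ′(w) · Υ(w)`. -/
theorem Ups_log_deriv (w : ℂ) (hw : w ∈ Complex.slitPlane) :
    DifferentiableAt ℂ Lam w ∧ Lam w ≠ 0 ∧
    DifferentiableAt ℂ Ups w ∧ Ups w ≠ 0 ∧
    deriv Ups w * Lam w = w * deriv Lam w * Ups w := by
  have hL := Lam_ne_zero hw
  have hU := Ups_ne_zero hw
  refine ⟨differentiableAt_Lam hw, hL, differentiableAt_Ups hw, hU, ?_⟩
  have h := logDeriv_Ups hw
  rwa [logDeriv_apply, logDeriv_apply, ← mul_div_assoc, div_eq_div_iff hU hL] at h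
end

section
/- For every w ∈ ℂ with Im(w) > 0 one has Λ(w) · Λ(−w) = (1 − e^{2πiw})^{−1}. -/
namespace Complex

theorem log_neg_eq_log_sub_pi_mul_I_of_im_pos {w : ℂ} (hw : 0 < w.im) :
    log (-w) = log w - Real.pi * I := by
  rw [log, log, arg_neg_eq_arg_sub_pi_of_im_pos hw, norm_neg]
  push_cast
  ring

theorem Gamma_mul_Gamma_neg {w : ℂ} (hw : w ≠ 0) :
    Gamma w * Gamma (-w) = -(Real.pi / (w * sin (Real.pi * w))) := by
  have h := Gamma_mul_Gamma_one_sub w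
  rw [show (1 : ℂ) - w = -w + 1 by ring, Gamma_add_one _ (neg_ne_zero.mpr hw)] at h
  rw [mul_comm w, ← div_div, ← h]
  field_simp

theorem exp_two_pi_mul_I_mul_ne_one_of_im_pos {w : ℂ} (hw : 0 < w.im) :
    exp (2 * Real.pi * I * w) ≠ 1 := by
  intro h
  have hn := congrArg norm h
  rw [norm_exp, norm_one, Real.exp_eq_one_iff] at hn
  simp [Real.pi_ne_zero, hw.ne'] at hn

end Complex

/-- For `Im w > 0` one has `Λ(w) · Λ(−w) = (1 − e^{2πiw})⁻¹`. -/
theorem Lam_reflection (w : ℂ) (hw : 0 < w.im) :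
    Lam w * Lam (-w) = (1 - Complex.exp (2 * Real.pi * Complex.I * w))⁻¹ := by
  have hw0 : w ≠ 0 := fun h => by simp [h] at hw
  have hE := Complex.exp_two_pi_mul_I_mul_ne_one_of_im_pos hw
  have hpow : Complex.exp ((w - 1 / 2) * Complex.log w) *
      Complex.exp ((-w - 1 / 2) * Complex.log (-w)) =
      w⁻¹ * Complex.exp (Real.pi * Complex.I * w) * Complex.I := by
    rw [Complex.log_neg_eq_log_sub_pi_mul_I_of_im_pos hw, ← Complex.exp_add,
      show (w - 1 / 2) * Complex.log w + (-w - 1 / 2) * (Complex.log w - Real.pi * Complex.I) =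
        -Complex.log w + Real.pi * Complex.I * w + Real.pi / 2 * Complex.I by ring,
      Complex.exp_add, Complex.exp_add, Complex.exp_neg, Complex.exp_log hw0,
      Complex.exp_pi_div_two_mul_I]
  have hsqrt : ((Real.sqrt (2 * Real.pi) : ℝ) : ℂ) * (Real.sqrt (2 * Real.pi) : ℝ) =
      2 * Real.pi := by
    rw [← Complex.ofReal_mul, Real.mul_self_sqrt (by positivity)]
    push_cast
    rfl
  have hpi : (Real.pi : ℂ) ≠ 0 := Complex.ofReal_ne_zero.mpr Real.pi_ne_zero
  have hee : Complex.exp w * Complex.exp (-w) = 1 := by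
    rw [← Complex.exp_add, add_neg_cancel, Complex.exp_zero]
  have hsq : Complex.exp (2 * Real.pi * Complex.I * w) =
      Complex.exp (Real.pi * Complex.I * w) ^ 2 := by
    rw [← Complex.exp_nat_mul]
    congr 1
    push_cast
    ring
  have hsin : 2 * Complex.I * Complex.exp (Real.pi * Complex.I * w) *
      Complex.sin (Real.pi * w) = Complex.exp (2 * Real.pi * Complex.I * w) - 1 := by
    rw [hsq, Complex.sin,
      show -(Real.pi * w) * Complex.I = -(Real.pi * Complex.I * w) by ring,
      show Real.pi * w * Complex.I = Real.pi * Complex.I * w by ring, Complex.exp_neg]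
    have := Complex.exp_ne_zero (Real.pi * Complex.I * w)
    field_simp
    rw [Complex.I_sq]
    ring
  have hs : Complex.sin (Real.pi * w) ≠ 0 := fun h => by
    rw [h, mul_zero] at hsin
    exact hE (sub_eq_zero.mp hsin.symm)
  have hEw := Complex.exp_ne_zero (Real.pi * Complex.I * w)
  calc Lam w * Lam (-w)
      = (Complex.exp w * Complex.exp (-w)) * (Complex.Gamma w * Complex.Gamma (-w)) /
        (((Real.sqrt (2 * Real.pi) : ℝ) * (Real.sqrt (2 * Real.pi) : ℝ)) *
          (Complex.exp ((w - 1 / 2) * Complex.log w) *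
            Complex.exp ((-w - 1 / 2) * Complex.log (-w)))) := by
        rw [Lam, Lam, div_mul_div_comm]
        congr 1 <;> ring
    _ = -(2 * Complex.I * Complex.exp (Real.pi * Complex.I * w) *
          Complex.sin (Real.pi * w))⁻¹ := by
        rw [hee, hsqrt, hpow, Complex.Gamma_mul_Gamma_neg hw0]
        field_simp
    _ = (1 - Complex.exp (2 * Real.pi * Complex.I * w))⁻¹ := by
        rw [hsin, ← inv_neg, neg_sub]
end
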